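/- Let f(x) = c_k x^k + ⋯ + c_0 ∈ ℤ[x] with c_k > 0 and k ≥ 1. There exists s₀ = s₀(k) such that for every integer s ≥ s₀ there is a constant C (depending on f and s) with ∫_0^1 |S_M(α)|^s dα ≤ C · M^{s−k} for all M ≥ 1. -/

import Mathlib

open Real Filter MeasureTheory

/-- The Weyl sum `S_M(α) = Σ_{d=1}^{M} e^{2πi f(d) α}`. -/
noncomputable def SM (f : Polynomial ℤ) (M : ℕ) (α : ℝ) : ℂ :=
  ∑ d ∈ Finset.Icc 1 M, Complex.exp (2 * Real.pi * Complex.I * (f.eval (d : ℤ)) * α)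


noncomputable def ee (n : ℤ) (α : ℝ) : ℂ := Complex.exp (2 * Real.pi * Complex.I * n * α)

lemma ee_zero (α : ℝ) : ee 0 α = 1 := by simp [ee]

lemma ee_add (m n : ℤ) (α : ℝ) : ee (m + n) α = ee m α * ee n α := by
  unfold ee; rw [← Complex.exp_add]; congr 1; push_cast; ring

lemma ee_mul (h m : ℤ) (α : ℝ) : ee (h * m) α = ee m (h * α) := by
  unfold ee; congr 1; push_cast; ring

lemma ee_norm (n : ℤ) (α : ℝ) : ‖ee n α‖ = 1 := by
  unfold ee
  have : (2 * Real.pi * Complex.I * n * α : ℂ) = ((2 * Real.pi * n * α : ℝ) : ℂ) * Complex.I := by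
    push_cast; ring
  rw [this, Complex.norm_exp_ofReal_mul_I]

lemma ee_conj (n : ℤ) (α : ℝ) : (starRingEnd ℂ) (ee n α) = ee (-n) α := by
  unfold ee; rw [← Complex.exp_conj]; congr 1
  have h2 : (starRingEnd ℂ) 2 = 2 := Complex.conj_ofNat 2
  simp [Complex.conj_ofReal, h2]

lemma ee_cont (n : ℤ) : Continuous (ee n) := by unfold ee; fun_prop

lemma ee_int (n : ℤ) : (∫ α in (0:ℝ)..1, ee n α) = if n = 0 then 1 else 0 := by
  split_ifs with h
  · subst h; simp [ee]
  · unfold ee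
    have hc : (2 * Real.pi * Complex.I * n : ℂ) ≠ 0 := by
      simp [h, Real.pi_ne_zero]
    rw [integral_exp_mul_complex hc]
    have : (2 * Real.pi * Complex.I * n : ℂ) * ((1:ℝ):ℂ) = n * (2 * Real.pi * Complex.I) := by
      push_cast; ring
    rw [this, Complex.exp_int_mul_two_pi_mul_I]; simp

lemma ee_prod {ι : Type*} (s : Finset ι) (G : ι → ℤ) (α : ℝ) :
    ee (∑ i ∈ s, G i) α = ∏ i ∈ s, ee (G i) α := by
  classical
  induction s using Finset.induction_on with
  | empty => simp [ee_zero]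
  | insert a s ha ih => rw [Finset.sum_insert ha, Finset.prod_insert ha, ee_add, ih]

noncomputable def TT (X : Finset ℤ) (g : ℤ → ℤ) (α : ℝ) : ℂ := ∑ x ∈ X, ee (g x) α

lemma TT_cont (X : Finset ℤ) (g : ℤ → ℤ) : Continuous (TT X g) := by
  unfold TT
  exact continuous_finsetSum _ (fun i _ => ee_cont _)

lemma TT_norm_le (X : Finset ℤ) (g : ℤ → ℤ) (α : ℝ) : ‖TT X g α‖ ≤ X.card := by
  unfold TT
  refine (norm_sum_le _ _).trans ?_
  simp [ee_norm]

lemma TT_sq (X : Finset ℤ) (g : ℤ → ℤ) (α : ℝ) :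
    ((‖TT X g α‖ ^ 2 : ℝ) : ℂ) = ∑ p ∈ X ×ˢ X, ee (g p.1 - g p.2) α := by
  have : ((‖TT X g α‖ ^ 2 : ℝ) : ℂ) = TT X g α * (starRingEnd ℂ) (TT X g α) := by
    rw [Complex.mul_conj, Complex.normSq_eq_norm_sq]
  rw [this, Finset.sum_product]
  unfold TT
  rw [map_sum, Finset.sum_mul_sum]
  refine Finset.sum_congr rfl fun x _ => Finset.sum_congr rfl fun y _ => ?_
  rw [ee_conj, sub_eq_add_neg, ee_add]

lemma TT_expand (X : Finset ℤ) (g : ℤ → ℤ) (t : ℕ) (R : ℕ) (hR : ∀ x ∈ X, |g x| ≤ R) :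
    ∃ r : ℤ → ℝ, (∀ m, 0 ≤ r m) ∧
      ∀ α : ℝ, ((‖TT X g α‖ ^ (2 * t) : ℝ) : ℂ) =
        ∑ m ∈ Finset.Icc (-(2 * t * R : ℕ) : ℤ) (2 * t * R : ℕ), (r m : ℂ) * ee m α := by
  classical
  let Y := Fintype.piFinset (fun _ : Fin t => X ×ˢ X)
  let G : (Fin t → ℤ × ℤ) → ℤ := fun p => ∑ i, (g (p i).1 - g (p i).2)
  refine ⟨fun m => ((Y.filter (fun p => G p = m)).card : ℝ), fun m => by positivity, fun α => ?_⟩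
  have h1 : ((‖TT X g α‖ ^ (2 * t) : ℝ) : ℂ) = ∑ p ∈ Y, ee (G p) α := by
    rw [pow_mul, Complex.ofReal_pow, TT_sq]
    have := Finset.prod_univ_sum (fun _ : Fin t => X ×ˢ X) (fun _ p => ee (g p.1 - g p.2) α)
    rw [Finset.prod_const, Finset.card_univ, Fintype.card_fin] at this
    rw [this]
    refine Finset.sum_congr rfl fun p _ => ?_
    rw [ee_prod]
  rw [h1]
  have hm : ∀ p ∈ Y, G p ∈ Finset.Icc (-(2 * t * R : ℕ) : ℤ) (2 * t * R : ℕ) := by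
    intro p hp
    rw [Fintype.mem_piFinset] at hp
    rw [Finset.mem_Icc, ← abs_le]
    calc |G p| ≤ ∑ i, |g (p i).1 - g (p i).2| := Finset.abs_sum_le_sum_abs _ _
      _ ≤ ∑ i : Fin t, (2 * R : ℤ) := by
        refine Finset.sum_le_sum fun i _ => ?_
        have := Finset.mem_product.1 (hp i)
        have h2 := hR _ this.1
        have h3 := hR _ this.2
        have := abs_sub (g (p i).1) (g (p i).2)
        linarith
      _ = _ := by simp; ring
  rw [← Finset.sum_fiberwise_of_maps_to hm]
  refine Finset.sum_congr rfl fun m _ => ?_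
  rw [Finset.sum_congr rfl (g := fun _ => ee m α)
    (fun p hp => by rw [(Finset.mem_filter.1 hp).2])]
  simp

lemma coef_le (F : ℝ → ℝ) (h0 : ∀ α, 0 ≤ F α) (A : Finset ℤ) (r : ℤ → ℝ)
    (h : ∀ α : ℝ, ((F α : ℝ) : ℂ) = ∑ m ∈ A, (r m : ℂ) * ee m α) (n : ℤ) (hn : n ∈ A) :
    r n ≤ ∫ α in (0:ℝ)..1, F α := by
  have h1 : (∫ α in (0:ℝ)..1, (F α : ℂ) * ee (-n) α) = r n := by
    have : ∀ α, (F α : ℂ) * ee (-n) α = ∑ m ∈ A, (r m : ℂ) * ee (m - n) α := by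
      intro α
      rw [h, Finset.sum_mul]
      refine Finset.sum_congr rfl fun m _ => ?_
      rw [sub_eq_add_neg, ee_add]; ring
    simp_rw [this]
    rw [intervalIntegral.integral_finsetSum]
    · simp_rw [intervalIntegral.integral_const_mul, ee_int, sub_eq_zero]
      simp [hn]
    · intro m _
      exact (continuous_const.mul (ee_cont _)).intervalIntegrable _ _
  have h2 : ‖(r n : ℂ)‖ ≤ ∫ α in (0:ℝ)..1, F α := by
    rw [← h1]
    refine (intervalIntegral.norm_integral_le_integral_norm zero_le_one).trans (le_of_eq ?_)
    refine intervalIntegral.integral_congr fun α _ => ?_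
    simp [ee_norm, abs_of_nonneg (h0 α)]
  rw [Complex.norm_real] at h2
  exact (le_abs_self _).trans h2

lemma res_card (A : Finset ℤ) (Q d : ℕ) (hd : 1 ≤ d) (hdQ : d ≤ Q)
    (hA : ∀ x ∈ A, |x| ≤ Q) (hmod : ∀ x ∈ A, ∀ y ∈ A, (d : ℤ) ∣ x - y) :
    A.card * d ≤ 3 * Q := by
  have h1 : A.card ≤ (Finset.range (2 * Q / d + 1)).card := by
    refine Finset.card_le_card_of_injOn (fun x => ((x + Q) / d).toNat) ?_ ?_
    · intro x hx
      have := abs_le.1 (hA x hx)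
      simp only [Finset.coe_range, Set.mem_Iio]
      have h2 : (x + Q) / (d:ℤ) ≤ (2 * Q) / d := Int.ediv_le_ediv (by omega) (by omega)
      have h3 : (((2 * Q / d : ℕ)) : ℤ) = (2 * Q) / d := by push_cast; rfl
      rw [← h3] at h2
      generalize 2 * Q / d = z at *
      omega
    · intro x hx y hy hxy
      have hx1 := abs_le.1 (hA x hx)
      have hy1 := abs_le.1 (hA y hy)
      have hxp : 0 ≤ (x + Q) / (d:ℤ) := Int.ediv_nonneg (by omega) (by omega)
      have hyp : 0 ≤ (y + Q) / (d:ℤ) := Int.ediv_nonneg (by omega) (by omega)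
      have h4 : (x + Q) / (d:ℤ) = (y + Q) / (d:ℤ) := by
        simp only at hxy; omega
      have h5 : (x + Q) % (d:ℤ) = (y + Q) % (d:ℤ) := by
        apply Int.emod_eq_emod_iff_emod_sub_eq_zero.2
        have := hmod x hx y hy
        have h6 : x + Q - (y + Q) = x - y := by ring
        rw [h6]; exact Int.emod_eq_zero_of_dvd this
      have h6 := Int.mul_ediv_add_emod (x + Q) d
      have h7 := Int.mul_ediv_add_emod (y + Q) d
      rw [h4, h5] at h6
      omega
  rw [Finset.card_range] at h1
  calc A.card * d ≤ (2 * Q / d + 1) * d := Nat.mul_le_mul_right _ h1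
    _ = 2 * Q / d * d + d := by ring
    _ ≤ 2 * Q + Q := Nat.add_le_add (Nat.div_mul_le_self _ _) hdQ
    _ = _ := by ring

/-- two-variable count -/
lemma two_card_aux (h1 h2 n : ℤ) (Q : ℕ) (h10 : h1 ≠ 0) (h20 : h2 ≠ 0) (h2Q : |h2| ≤ Q)
    (A : Finset (ℤ × ℤ)) (hA : ∀ p ∈ A, |p.1| ≤ Q ∧ h1 * p.1 + h2 * p.2 = n) :
    A.card * h2.natAbs ≤ 3 * Q * Int.gcd h1 h2 := by
  have hg : 0 < Int.gcd h1 h2 := Int.gcd_pos_of_ne_zero_left _ h10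
  have hgd : (Int.gcd h1 h2) ∣ h2.natAbs := Nat.gcd_dvd_right _ _
  obtain ⟨d, hd⟩ := hgd
  have hd0 : 1 ≤ d := by
    rcases Nat.eq_zero_or_pos d with h | h
    · subst h; simp at hd; exact absurd hd h20
    · exact h
  have hinj : Set.InjOn Prod.fst (A : Set (ℤ × ℤ)) := by
    intro p hp q hq hpq
    have e1 := (hA p hp).2
    have e2 := (hA q hq).2
    rw [hpq] at e1
    have : h2 * p.2 = h2 * q.2 := by linarith
    exact Prod.ext hpq (mul_left_cancel₀ h20 this)
  have hc := Finset.card_image_of_injOn hinj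
  have := res_card (A.image Prod.fst) Q d hd0 ?_ ?_ ?_
  · rw [hc] at this
    calc A.card * h2.natAbs = (A.card * d) * Int.gcd h1 h2 := by rw [hd]; ring
      _ ≤ _ := Nat.mul_le_mul_right _ this
  · have : d ≤ h2.natAbs := by rw [hd]; exact Nat.le_mul_of_pos_left _ hg
    rw [Int.abs_eq_natAbs] at h2Q
    omega
  · intro x hx
    obtain ⟨p, hp, rfl⟩ := Finset.mem_image.1 hx
    exact (hA p hp).1
  · intro x hx y hy
    obtain ⟨p, hp, rfl⟩ := Finset.mem_image.1 hx
    obtain ⟨q, hq, rfl⟩ := Finset.mem_image.1 hy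
    have e1 := (hA p hp).2
    have e2 := (hA q hq).2
    have e3 : h2 ∣ h1 * (p.1 - q.1) := ⟨q.2 - p.2, by linarith⟩
    have e4 : h2.natAbs ∣ h1.natAbs * (p.1 - q.1).natAbs := by
      rw [← Int.natAbs_mul]; exact Int.natAbs_dvd_natAbs.2 e3
    have e5 : h2.natAbs / Nat.gcd h2.natAbs h1.natAbs ∣ (p.1 - q.1).natAbs :=
      Nat.Coprime.dvd_of_dvd_mul_left
        (Nat.coprime_div_gcd_div_gcd (m := h2.natAbs) (n := h1.natAbs) (by rw [Nat.gcd_comm]; exact hg))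
        (by
          have := Nat.div_dvd_div (Nat.gcd_dvd_left h2.natAbs h1.natAbs) e4
          rwa [Nat.mul_div_right_comm (Nat.gcd_dvd_right h2.natAbs h1.natAbs)] at this)
    have e6 : h2.natAbs / Nat.gcd h2.natAbs h1.natAbs = d := by
      rw [Nat.gcd_comm]
      exact Nat.div_eq_of_eq_mul_right hg hd
    rw [e6] at e5
    exact Int.natCast_dvd.2 e5

lemma two_card (h1 h2 n : ℤ) (Q : ℕ) (h10 : h1 ≠ 0) (h20 : h2 ≠ 0) (h1Q : |h1| ≤ Q) (h2Q : |h2| ≤ Q)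
    (A : Finset (ℤ × ℤ)) (hA : ∀ p ∈ A, |p.1| ≤ Q ∧ |p.2| ≤ Q ∧ h1 * p.1 + h2 * p.2 = n) :
    (A.card : ℝ) * (√(h1.natAbs) * √(h2.natAbs)) ≤ 3 * Q * Int.gcd h1 h2 := by
  have a2 := two_card_aux h1 h2 n Q h10 h20 h2Q A (fun p hp => ⟨(hA p hp).1, (hA p hp).2.2⟩)
  have a1 := two_card_aux h2 h1 n Q h20 h10 h1Q (A.map (Equiv.prodComm ℤ ℤ).toEmbedding) (by
    intro p hp
    simp only [Finset.mem_map_equiv] at hp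
    have := hA _ hp
    simp at this
    exact ⟨this.2.1, by linarith [this.2.2]⟩)
  rw [Finset.card_map, Int.gcd_comm] at a1
  have b1 : (A.card : ℝ) * h1.natAbs ≤ 3 * Q * Int.gcd h1 h2 := by exact_mod_cast a1
  have b2 : (A.card : ℝ) * h2.natAbs ≤ 3 * Q * Int.gcd h1 h2 := by exact_mod_cast a2
  have s1 := Real.sq_sqrt (Nat.cast_nonneg (α := ℝ) h1.natAbs)
  have s2 := Real.sq_sqrt (Nat.cast_nonneg (α := ℝ) h2.natAbs)
  have : √(h1.natAbs) * √(h2.natAbs) ≤ ((h1.natAbs:ℝ) + h2.natAbs) / 2 := by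
    nlinarith [sq_nonneg (√(h1.natAbs:ℝ) - √(h2.natAbs:ℝ))]
  have hc : (0:ℝ) ≤ A.card := by positivity
  nlinarith [mul_le_mul_of_nonneg_left this hc]

lemma three_card (h1 h2 h3 : ℤ) (Q : ℕ) (h10 : h1 ≠ 0) (h20 : h2 ≠ 0)
    (h1Q : |h1| ≤ Q) (h2Q : |h2| ≤ Q)
    (A : Finset (ℤ × ℤ × ℤ)) (hA : ∀ p ∈ A, |p.1| ≤ Q ∧ |p.2.1| ≤ Q ∧ |p.2.2| ≤ Q ∧
      h1 * p.1 + h2 * p.2.1 + h3 * p.2.2 = 0) :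
    (A.card : ℝ) * (√(h1.natAbs) * √(h2.natAbs)) ≤
      9 * Q ^ 2 * (Nat.gcd (Int.gcd h1 h2) h3.natAbs : ℕ) := by
  classical
  set g := Int.gcd h1 h2 with hgdef
  have hg : 0 < g := Int.gcd_pos_of_ne_zero_left _ h10
  set g3 := Nat.gcd g h3.natAbs with hg3
  have hg3p : 0 < g3 := Nat.gcd_pos_of_pos_left _ hg
  set M3 := A.image (fun p => p.2.2) with hM3
  obtain ⟨d, hd⟩ : g3 ∣ g := Nat.gcd_dvd_left _ _
  have hd0 : 1 ≤ d := by
    rcases Nat.eq_zero_or_pos d with h | h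
    · subst h; omega
    · exact h
  have c1 : M3.card * d ≤ 3 * Q := by
    refine res_card M3 Q d hd0 ?_ ?_ ?_
    · have e1 : d ≤ g := by rw [hd]; exact Nat.le_mul_of_pos_left _ hg3p
      have e2 : g ≤ h1.natAbs := Nat.le_of_dvd (by omega) (Nat.gcd_dvd_left _ _)
      rw [Int.abs_eq_natAbs] at h1Q
      omega
    · intro x hx
      obtain ⟨p, hp, rfl⟩ := Finset.mem_image.1 hx
      exact (hA p hp).2.2.1
    · intro x hx y hy
      obtain ⟨p, hp, rfl⟩ := Finset.mem_image.1 hx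
      obtain ⟨q, hq, rfl⟩ := Finset.mem_image.1 hy
      have e1 := (hA p hp).2.2.2
      have e2 := (hA q hq).2.2.2
      have e3 : (g : ℤ) ∣ h3 * (p.2.2 - q.2.2) := by
        have : h3 * (p.2.2 - q.2.2) = h1 * (q.1 - p.1) + h2 * (q.2.1 - p.2.1) := by linarith
        rw [this]
        exact dvd_add (Dvd.dvd.mul_right (Int.gcd_dvd_left h1 h2) _)
          (Dvd.dvd.mul_right (Int.gcd_dvd_right h1 h2) _)
      have e4 : g ∣ h3.natAbs * (p.2.2 - q.2.2).natAbs := by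
        rw [← Int.natAbs_mul]; exact Int.natCast_dvd.1 e3
      have e5 : g / g3 ∣ (p.2.2 - q.2.2).natAbs :=
        Nat.Coprime.dvd_of_dvd_mul_left
          (Nat.coprime_div_gcd_div_gcd (m := g) (n := h3.natAbs) hg3p)
          (by
            have := Nat.div_dvd_div (Nat.gcd_dvd_left g h3.natAbs) e4
            rwa [Nat.mul_div_right_comm (Nat.gcd_dvd_right g h3.natAbs)] at this)
      have e6 : g / g3 = d := Nat.div_eq_of_eq_mul_right hg3p hd
      rw [e6] at e5
      exact Int.natCast_dvd.2 e5
  have c2 : (A.card : ℝ) = ∑ m ∈ M3, ((A.filter (fun p => p.2.2 = m)).card : ℝ) := by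
    exact_mod_cast Finset.card_eq_sum_card_fiberwise (f := fun p : ℤ × ℤ × ℤ => p.2.2) (s := A) (t := M3)
      (fun p hp => Finset.mem_image_of_mem _ hp)
  rw [c2, Finset.sum_mul]
  have c3 : ∀ m ∈ M3, ((A.filter (fun p => p.2.2 = m)).card : ℝ) * (√(h1.natAbs) * √(h2.natAbs)) ≤
      3 * Q * g := by
    intro m _
    have hinj : Set.InjOn (fun p : ℤ × ℤ × ℤ => (p.1, p.2.1)) (A.filter (fun p => p.2.2 = m) : Set (ℤ × ℤ × ℤ)) := by
      rintro ⟨a, b, c⟩ hp ⟨a', b', c'⟩ hq hpq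
      simp at hp hq hpq ⊢
      omega
    rw [← Finset.card_image_of_injOn hinj]
    refine two_card h1 h2 (-(h3 * m)) Q h10 h20 h1Q h2Q _ ?_
    intro p hp
    obtain ⟨q, hq, rfl⟩ := Finset.mem_image.1 hp
    obtain ⟨hq1, hq2⟩ := Finset.mem_filter.1 hq
    have := hA q hq1
    rw [hq2] at this
    exact ⟨this.1, this.2.1, by simp only; linarith [this.2.2.2]⟩
  refine (Finset.sum_le_sum c3).trans ?_
  rw [Finset.sum_const, nsmul_eq_mul]
  have c4 : (M3.card : ℝ) * d ≤ 3 * Q := by exact_mod_cast c1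
  have c5 : (g : ℝ) = g3 * d := by exact_mod_cast hd
  rw [c5]
  calc (M3.card : ℝ) * (3 * Q * (g3 * d)) = (M3.card * d) * (3 * Q * g3) := by ring
    _ ≤ (3 * Q) * (3 * Q * g3) := by gcongr
    _ = _ := by ring

noncomputable def HH (N : ℕ) : Finset ℤ := (Finset.Icc (-(N:ℤ)) N).erase 0

lemma sum_HH (N : ℕ) (φ : ℕ → ℝ) :
    ∑ h ∈ HH N, φ h.natAbs = 2 * ∑ n ∈ Finset.Icc 1 N, φ n := by
  have : HH N = (Finset.Icc 1 N).image (fun n : ℕ => (n:ℤ)) ∪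
      (Finset.Icc 1 N).image (fun n : ℕ => -(n:ℤ)) := by
    ext x
    simp only [HH, Finset.mem_erase, Finset.mem_Icc, Finset.mem_union, Finset.mem_image]
    constructor
    · rintro ⟨h0, h1, h2⟩
      rcases lt_or_gt_of_ne h0 with h | h
      · right; exact ⟨x.natAbs, by omega, by omega⟩
      · left; exact ⟨x.natAbs, by omega, by omega⟩
    · rintro (⟨n, hn, rfl⟩ | ⟨n, hn, rfl⟩) <;> omega
  rw [this, Finset.sum_union]
  · rw [Finset.sum_image (fun a _ b _ h => by simpa using h),
      Finset.sum_image (fun a _ b _ h => by simpa using h)]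
    simp [two_mul]
  · rw [Finset.disjoint_left]
    intro x hx hy
    simp only [Finset.mem_image, Finset.mem_Icc] at hx hy
    obtain ⟨a, ha, rfl⟩ := hx
    obtain ⟨b, hb, hb2⟩ := hy
    omega

lemma sum_dvd (N g : ℕ) (hg : 1 ≤ g) (φ : ℕ → ℝ) :
    ∑ n ∈ Finset.Icc 1 N, (if g ∣ n then φ n else 0) = ∑ m ∈ Finset.Icc 1 (N / g), φ (g * m) := by
  rw [← Finset.sum_filter]
  have : (Finset.Icc 1 N).filter (fun n => g ∣ n) =
      (Finset.Icc 1 (N / g)).image (fun m => g * m) := by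
    ext n
    simp only [Finset.mem_filter, Finset.mem_Icc, Finset.mem_image]
    constructor
    · rintro ⟨⟨h1, h2⟩, m, rfl⟩
      refine ⟨m, ⟨?_, ?_⟩, rfl⟩
      · exact Nat.pos_of_mul_pos_left h1
      · rw [Nat.le_div_iff_mul_le hg]; linarith [mul_comm g m]
    · rintro ⟨m, ⟨h1, h2⟩, rfl⟩
      rw [Nat.le_div_iff_mul_le hg] at h2
      exact ⟨⟨Nat.mul_pos hg h1, by linarith [mul_comm g m]⟩, dvd_mul_right _ _⟩
  rw [this, Finset.sum_image (fun a _ b _ h => Nat.eq_of_mul_eq_mul_left hg h)]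

lemma sum_inv_sqrt (K : ℕ) : ∑ m ∈ Finset.Icc 1 K, 1 / √(m:ℝ) ≤ 2 * √(K:ℝ) := by
  induction K with
  | zero => simp
  | succ K ih =>
    rw [Finset.sum_Icc_succ_top (by omega)]
    have s1 := Real.sq_sqrt (Nat.cast_nonneg (α := ℝ) K)
    have s2 := Real.sq_sqrt (Nat.cast_nonneg (α := ℝ) (K+1))
    have p1 := Real.sqrt_nonneg (K:ℝ)
    have p2 : 0 < √((K+1 : ℕ):ℝ) := Real.sqrt_pos.2 (by positivity)
    have : 1 / √((K+1 : ℕ):ℝ) ≤ 2 * √((K+1 : ℕ):ℝ) - 2 * √(K:ℝ) := by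
      rw [div_le_iff₀ p2]
      have : ((K+1 : ℕ) : ℝ) = K + 1 := by push_cast; ring
      nlinarith [sq_nonneg (√((K+1 : ℕ):ℝ) - √(K:ℝ))]
    linarith

lemma sum_inv_sq (K : ℕ) : ∑ m ∈ Finset.Icc 1 K, 1 / (m:ℝ)^2 ≤ 2 := by
  have : ∑ m ∈ Finset.Icc 1 K, 1 / (m:ℝ)^2 ≤ 2 - 1 / (K:ℝ) := by
    induction K with
    | zero => simp
    | succ K ih =>
      rw [Finset.sum_Icc_succ_top (by omega)]
      rcases Nat.eq_zero_or_pos K with h | h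
      · subst h; norm_num
      have hK : (0:ℝ) < K := by exact_mod_cast h
      have : 1 / ((K+1 : ℕ):ℝ)^2 ≤ 1 / (K:ℝ) - 1 / ((K+1 : ℕ) : ℝ) := by
        push_cast
        rw [div_sub_div _ _ (by positivity) (by positivity), div_le_div_iff₀ (by positivity) (by positivity)]
        nlinarith
      linarith
  have h2 : (0:ℝ) ≤ 1 / (K:ℝ) := by positivity
  linarith

lemma sumA (N g : ℕ) (hg : 1 ≤ g) :
    ∑ h ∈ HH N, (if g ∣ h.natAbs then (1:ℝ) else 0) ≤ 2 * (N / g) := by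
  rw [sum_HH N (fun n => if g ∣ n then (1:ℝ) else 0), sum_dvd N g hg (fun _ => 1)]
  simp only [Finset.sum_const, Nat.card_Icc, nsmul_eq_mul, mul_one]
  gcongr
  simpa using Nat.cast_div_le (α := ℝ) (m := N) (n := g)

lemma sumB (N g : ℕ) (hg : 1 ≤ g) :
    ∑ h ∈ HH N, (if g ∣ h.natAbs then 1 / √(h.natAbs : ℝ) else 0) ≤ 4 * √N / g := by
  rw [sum_HH N (fun n => if g ∣ n then 1 / √(n:ℝ) else 0), sum_dvd N g hg (fun n => 1 / √(n:ℝ))]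
  have h1 : ∀ m : ℕ, 1 / √((g * m : ℕ):ℝ) = 1 / √(g:ℝ) * (1 / √(m:ℝ)) := by
    intro m
    rw [Nat.cast_mul, Real.sqrt_mul (by positivity)]
    field_simp
  simp_rw [h1]
  rw [← Finset.mul_sum]
  have hgp : (0:ℝ) < g := by exact_mod_cast hg
  have h2 : √((N / g : ℕ) : ℝ) ≤ √N / √g := by
    rw [← Real.sqrt_div (by positivity)]
    exact Real.sqrt_le_sqrt Nat.cast_div_le
  calc 2 * (1 / √(g:ℝ) * ∑ m ∈ Finset.Icc 1 (N/g), 1 / √(m:ℝ))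
      ≤ 2 * (1 / √(g:ℝ) * (2 * (√N / √g))) := by
        gcongr
        exact (sum_inv_sqrt _).trans (by linarith)
    _ = 4 * √N / (√g * √g) := by field_simp; ring
    _ = _ := by rw [Real.mul_self_sqrt hgp.le]

lemma gcd_sum (N : ℕ) :
    ∑ h1 ∈ HH N, ∑ h2 ∈ HH N, ∑ h3 ∈ HH N,
      (Nat.gcd (Int.gcd h1 h2) h3.natAbs : ℝ) * (1 / √(h1.natAbs:ℝ)) * (1 / √(h2.natAbs:ℝ)) ≤ 64 * (N:ℝ)^2 := by
  have key : ∀ h1 ∈ HH N, ∀ h2 ∈ HH N, ∀ h3 ∈ HH N,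
      (Nat.gcd (Int.gcd h1 h2) h3.natAbs : ℝ) * (1 / √(h1.natAbs:ℝ)) * (1 / √(h2.natAbs:ℝ)) ≤
      ∑ g ∈ Finset.Icc 1 N, (g:ℝ) * (if g ∣ h1.natAbs then 1 / √(h1.natAbs : ℝ) else 0) *
        (if g ∣ h2.natAbs then 1 / √(h2.natAbs : ℝ) else 0) * (if g ∣ h3.natAbs then (1:ℝ) else 0) := by
    intro h1 hh1 h2 hh2 h3 hh3
    set g := Nat.gcd (Int.gcd h1 h2) h3.natAbs with hg
    have d1 : g ∣ h1.natAbs := (Nat.gcd_dvd_left _ _).trans (Nat.gcd_dvd_left _ _)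
    have d2 : g ∣ h2.natAbs := (Nat.gcd_dvd_left _ _).trans (Nat.gcd_dvd_right _ _)
    have d3 : g ∣ h3.natAbs := Nat.gcd_dvd_right _ _
    simp only [HH, Finset.mem_erase, Finset.mem_Icc] at hh1
    have gpos : 0 < g := Nat.pos_of_dvd_of_pos d1 (by omega)
    have gle : g ≤ h1.natAbs := Nat.le_of_dvd (by omega) d1
    refine le_trans (le_of_eq ?_) (Finset.single_le_sum (f := fun g : ℕ => (g:ℝ) * (if g ∣ h1.natAbs then 1 / √(h1.natAbs : ℝ) else 0) *
        (if g ∣ h2.natAbs then 1 / √(h2.natAbs : ℝ) else 0) * (if g ∣ h3.natAbs then (1:ℝ) else 0)) ?_ (Finset.mem_Icc.2 ⟨gpos, (by omega : g ≤ N)⟩))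
    · simp only [d1, d2, d3, if_true, mul_one]
    · intro i _
      positivity
  have step : ∑ h1 ∈ HH N, ∑ h2 ∈ HH N, ∑ h3 ∈ HH N,
      (Nat.gcd (Int.gcd h1 h2) h3.natAbs : ℝ) * (1 / √(h1.natAbs:ℝ)) * (1 / √(h2.natAbs:ℝ)) ≤
      ∑ g ∈ Finset.Icc 1 N, (g:ℝ) * (∑ h ∈ HH N, if g ∣ h.natAbs then 1 / √(h.natAbs : ℝ) else 0) *
        (∑ h ∈ HH N, if g ∣ h.natAbs then 1 / √(h.natAbs : ℝ) else 0) *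
        (∑ h ∈ HH N, if g ∣ h.natAbs then (1:ℝ) else 0) := by
    refine (Finset.sum_le_sum fun h1 hh1 => Finset.sum_le_sum fun h2 hh2 =>
      Finset.sum_le_sum fun h3 hh3 => key h1 hh1 h2 hh2 h3 hh3).trans (le_of_eq ?_)
    have e : ∀ (c : ℝ) (u v w : ℤ → ℝ), c * (∑ h ∈ HH N, u h) * (∑ h ∈ HH N, v h) * (∑ h ∈ HH N, w h)
        = ∑ h1 ∈ HH N, ∑ h2 ∈ HH N, ∑ h3 ∈ HH N, c * u h1 * v h2 * w h3 := by
      intro c u v w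
      rw [Finset.mul_sum (s := HH N) (f := u), Finset.sum_mul_sum, Finset.sum_mul]
      refine Finset.sum_congr rfl fun h1 _ => ?_
      rw [Finset.sum_mul_sum]
    simp_rw [e]
    rw [Finset.sum_comm (s := Finset.Icc 1 N)]
    refine Finset.sum_congr rfl fun h1 _ => ?_
    rw [Finset.sum_comm (s := Finset.Icc 1 N)]
    refine Finset.sum_congr rfl fun h2 _ => ?_
    rw [Finset.sum_comm (s := Finset.Icc 1 N)]
  refine step.trans ?_
  calc _ ≤ ∑ g ∈ Finset.Icc 1 N, (g:ℝ) * (4 * √N / g) * (4 * √N / g) * (2 * (N / g)) := by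
        refine Finset.sum_le_sum fun g hg => ?_
        have hg1 := (Finset.mem_Icc.1 hg).1
        have a := sumA N g hg1
        have b := sumB N g hg1
        have b0 : 0 ≤ ∑ h ∈ HH N, (if g ∣ h.natAbs then 1 / √(h.natAbs : ℝ) else 0) :=
          Finset.sum_nonneg fun i _ => by positivity
        have a0 : 0 ≤ ∑ h ∈ HH N, (if g ∣ h.natAbs then (1:ℝ) else 0) :=
          Finset.sum_nonneg fun i _ => by positivity
        gcongr
    _ = ∑ g ∈ Finset.Icc 1 N, 32 * (N:ℝ)^2 * (1 / (g:ℝ)^2) := by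
        refine Finset.sum_congr rfl fun g hg => ?_
        have hg1 := (Finset.mem_Icc.1 hg).1
        have hgp : (0:ℝ) < g := by exact_mod_cast hg1
        have s1 := Real.sq_sqrt (Nat.cast_nonneg (α := ℝ) N)
        field_simp
        rw [s1]; ring
    _ = 32 * (N:ℝ)^2 * ∑ g ∈ Finset.Icc 1 N, (1 / (g:ℝ)^2) := by rw [Finset.mul_sum]
    _ ≤ 32 * (N:ℝ)^2 * 2 := by gcongr; exact sum_inv_sq N
    _ = _ := by ring

def pol (k : ℕ) (a : ℕ → ℤ) (x : ℤ) : ℤ := ∑ i ∈ Finset.range (k + 1), a i * x ^ i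

def dif (k : ℕ) (a : ℕ → ℤ) (h : ℤ) (i : ℕ) : ℤ :=
  ∑ l ∈ Finset.range (k + 2), if i < l then a l * (l.choose i) * h ^ (l - i - 1) else 0

lemma dif_eval (k : ℕ) (a : ℕ → ℤ) (h x : ℤ) :
    h * pol k (dif k a h) x = pol (k + 1) a (x + h) - pol (k + 1) a x := by
  unfold pol dif
  rw [← Finset.sum_sub_distrib]
  simp_rw [Finset.sum_mul]
  rw [Finset.sum_comm, Finset.mul_sum]
  refine Finset.sum_congr rfl fun l hl => ?_
  have hl' := Finset.mem_range.1 hl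
  rw [add_pow, Finset.sum_range_succ _ l]
  have : ∑ i ∈ Finset.range (k + 1), (if i < l then a l * (l.choose i) * h ^ (l - i - 1) else 0) * x ^ i
      = ∑ i ∈ Finset.range l, a l * (l.choose i) * h ^ (l - i - 1) * x ^ i := by
    simp_rw [ite_mul, zero_mul]
    rw [← Finset.sum_filter]
    refine Finset.sum_congr ?_ fun _ _ => rfl
    ext i; simp; omega
  rw [this]
  simp only [Nat.choose_self, Nat.cast_one, mul_one, Nat.sub_self, pow_zero]
  rw [mul_add, add_sub_cancel_right, Finset.mul_sum, Finset.mul_sum]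
  refine Finset.sum_congr rfl fun i hi => ?_
  have : l - i = (l - i - 1) + 1 := by have := Finset.mem_range.1 hi; omega
  conv_rhs => rw [this, pow_succ]
  ring

lemma dif_top (k : ℕ) (a : ℕ → ℤ) (h : ℤ) : dif k a h k = a (k + 1) * (k + 1) := by
  unfold dif
  rw [Finset.sum_range_succ, Finset.sum_eq_zero]
  · simp
  · intro l hl
    have := Finset.mem_range.1 hl
    rw [if_neg (by omega)]

lemma dif_bound (k c P : ℕ) (a : ℕ → ℤ) (h : ℤ) (hh : |h| ≤ 2 * P)
    (ha : ∀ i ≤ k + 1, |a i| ≤ c * (P:ℤ) ^ (k + 1 - i)) (i : ℕ) (hi : i ≤ k) :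
    |dif k a h i| ≤ (((k + 2) * (c * 4 ^ (k + 1)) : ℕ) : ℤ) * (P:ℤ) ^ (k - i) := by
  unfold dif
  refine (Finset.abs_sum_le_sum_abs _ _).trans ?_
  have : ∀ l ∈ Finset.range (k + 2), |if i < l then a l * (l.choose i) * h ^ (l - i - 1) else 0| ≤
      ((c * 4 ^ (k + 1) : ℕ) : ℤ) * (P:ℤ) ^ (k - i) := by
    intro l hl
    have hl' := Finset.mem_range.1 hl
    split_ifs with hil
    · rw [abs_mul, abs_mul, abs_pow, Nat.abs_cast]
      have h1 : ((l.choose i : ℕ) : ℤ) ≤ 2 ^ (k + 1) := by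
        have : l.choose i ≤ 2 ^ (k+1) := (Nat.choose_le_two_pow _ _).trans (Nat.pow_le_pow_right (by norm_num) (by omega))
        exact_mod_cast this
      have h2 : |h| ^ (l - i - 1) ≤ 2 ^ (k + 1) * (P:ℤ) ^ (l - i - 1) := by
        calc |h| ^ (l - i - 1) ≤ (2 * (P:ℤ)) ^ (l - i - 1) := by gcongr
          _ = 2 ^ (l - i - 1) * (P:ℤ) ^ (l - i - 1) := by rw [mul_pow]
          _ ≤ _ := by gcongr <;> omega
      calc |a l| * (l.choose i : ℤ) * |h| ^ (l - i - 1) ≤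
          (c * (P:ℤ) ^ (k + 1 - l)) * 2 ^ (k + 1) * (2 ^ (k + 1) * (P:ℤ) ^ (l - i - 1)) := by
            have := ha l (by omega)
            gcongr
        _ = c * (2 ^ (k+1) * 2 ^ (k+1)) * ((P:ℤ) ^ (k + 1 - l) * (P:ℤ) ^ (l - i - 1)) := by ring
        _ = _ := by
            rw [← mul_pow, ← pow_add]
            have : k + 1 - l + (l - i - 1) = k - i := by omega
            rw [this]; push_cast; norm_num
    · simp; positivity
  refine (Finset.sum_le_sum this).trans (le_of_eq ?_)
  rw [Finset.sum_const, Finset.card_range, nsmul_eq_mul]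
  push_cast; ring

lemma pol_bound (k c P : ℕ) (a : ℕ → ℤ)
    (ha : ∀ i ≤ k, |a i| ≤ c * (P:ℤ) ^ (k - i)) (x : ℤ) (hx : |x| ≤ P) :
    |pol k a x| ≤ (((k + 1) * c * P ^ k : ℕ) : ℤ) := by
  unfold pol
  refine (Finset.abs_sum_le_sum_abs _ _).trans ?_
  have : ∀ i ∈ Finset.range (k + 1), |a i * x ^ i| ≤ c * (P:ℤ) ^ k := by
    intro i hi
    have hi' := Finset.mem_range.1 hi
    rw [abs_mul, abs_pow]
    calc |a i| * |x| ^ i ≤ (c * (P:ℤ) ^ (k - i)) * (P:ℤ) ^ i := by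
          have := ha i (by omega)
          gcongr
      _ = c * (P:ℤ) ^ (k - i + i) := by rw [pow_add]; ring
      _ = _ := by congr 2; omega
  refine (Finset.sum_le_sum this).trans (le_of_eq ?_)
  rw [Finset.sum_const, Finset.card_range, nsmul_eq_mul]
  push_cast; ring

lemma U_cube (N Q : ℕ) (hNQ : N ≤ Q) (B : ℝ) (zB : 0 ≤ B) (F : ℤ → ℝ → ℝ) (r : ℤ → ℤ → ℝ)
    (hF : ∀ h ∈ HH N, ∀ β : ℝ, ((F h β : ℝ) : ℂ) = ∑ m ∈ Finset.Icc (-(Q:ℤ)) Q, (r h m : ℂ) * ee m β)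
    (hr0 : ∀ h m, 0 ≤ r h m) (hrB : ∀ h ∈ HH N, ∀ m ∈ Finset.Icc (-(Q:ℤ)) Q, r h m ≤ B) :
    (∫ α in (0:ℝ)..1, (∑ h ∈ HH N, F h (h * α)) ^ 3) ≤ B ^ 3 * (576 * (Q:ℝ) ^ 2 * (N:ℝ) ^ 2) := by
  classical
  set I := Finset.Icc (-(Q:ℤ)) Q with hI
  set D := HH N ×ˢ I with hD
  have e1 : ∀ α : ℝ, (((∑ h ∈ HH N, F h (h * α)) ^ 3 : ℝ) : ℂ) =
      ∑ p ∈ D, ∑ q ∈ D, ∑ s ∈ D, ((r p.1 p.2 * r q.1 q.2 * r s.1 s.2 : ℝ) : ℂ) *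
        ee (p.1 * p.2 + q.1 * q.2 + s.1 * s.2) α := by
    intro α
    have e2 : ((∑ h ∈ HH N, F h (h * α) : ℝ) : ℂ) = ∑ p ∈ D, (r p.1 p.2 : ℂ) * ee (p.1 * p.2) α := by
      rw [Complex.ofReal_sum, hD, Finset.sum_product]
      refine Finset.sum_congr rfl fun h hh => ?_
      rw [hF h hh]
      refine Finset.sum_congr rfl fun m _ => ?_
      rw [ee_mul]
    rw [Complex.ofReal_pow, e2, pow_succ, pow_two, Finset.sum_mul_sum, Finset.sum_mul]
    refine Finset.sum_congr rfl fun p _ => ?_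
    rw [Finset.sum_mul_sum]
    refine Finset.sum_congr rfl fun q _ => Finset.sum_congr rfl fun s _ => ?_
    rw [ee_add, ee_add]; push_cast; ring
  have e3 : (∫ α in (0:ℝ)..1, (∑ h ∈ HH N, F h (h * α)) ^ 3) =
      ∑ p ∈ D, ∑ q ∈ D, ∑ s ∈ D, (r p.1 p.2 * r q.1 q.2 * r s.1 s.2) *
        (if p.1 * p.2 + q.1 * q.2 + s.1 * s.2 = 0 then (1:ℝ) else 0) := by
    apply Complex.ofReal_injective
    rw [← intervalIntegral.integral_ofReal]
    simp_rw [e1]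
    rw [intervalIntegral.integral_finsetSum]
    swap
    · intro p _
      refine Continuous.intervalIntegrable ?_ _ _
      exact continuous_finsetSum _ fun _ _ => continuous_finsetSum _ fun _ _ =>
        continuous_const.mul (ee_cont _)
    rw [Complex.ofReal_sum]
    refine Finset.sum_congr rfl fun p _ => ?_
    rw [intervalIntegral.integral_finsetSum]
    swap
    · intro p _
      refine Continuous.intervalIntegrable ?_ _ _
      exact continuous_finsetSum _ fun _ _ => continuous_const.mul (ee_cont _)
    rw [Complex.ofReal_sum]
    refine Finset.sum_congr rfl fun q _ => ?_
    rw [intervalIntegral.integral_finsetSum]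
    swap
    · intro p _
      refine Continuous.intervalIntegrable ?_ _ _
      exact continuous_const.mul (ee_cont _)
    rw [Complex.ofReal_sum]
    refine Finset.sum_congr rfl fun s _ => ?_
    rw [intervalIntegral.integral_const_mul, ee_int, Complex.ofReal_mul]
    congr 1
    split_ifs <;> simp
  rw [e3]
  have e4 : ∑ p ∈ D, ∑ q ∈ D, ∑ s ∈ D, (r p.1 p.2 * r q.1 q.2 * r s.1 s.2) *
        (if p.1 * p.2 + q.1 * q.2 + s.1 * s.2 = 0 then (1:ℝ) else 0) ≤
      ∑ p ∈ D, ∑ q ∈ D, ∑ s ∈ D, B ^ 3 *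
        (if p.1 * p.2 + q.1 * q.2 + s.1 * s.2 = 0 then (1:ℝ) else 0) := by
    refine Finset.sum_le_sum fun p hp => Finset.sum_le_sum fun q hq => Finset.sum_le_sum fun s hs => ?_
    have hp' := Finset.mem_product.1 hp
    have hq' := Finset.mem_product.1 hq
    have hs' := Finset.mem_product.1 hs
    have b1 := hrB _ hp'.1 _ hp'.2
    have b2 := hrB _ hq'.1 _ hq'.2
    have b3 := hrB _ hs'.1 _ hs'.2
    have z1 := hr0 p.1 p.2
    have z2 := hr0 q.1 q.2
    have z3 := hr0 s.1 s.2
    refine mul_le_mul_of_nonneg_right ?_ (by positivity)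
    calc r p.1 p.2 * r q.1 q.2 * r s.1 s.2 ≤ B * B * B := by gcongr
      _ = B ^ 3 := by ring
  refine e4.trans ?_
  simp_rw [← Finset.mul_sum]
  refine mul_le_mul_of_nonneg_left ?_ (by positivity)
  have e5 : ∑ p ∈ D, ∑ q ∈ D, ∑ s ∈ D,
        (if p.1 * p.2 + q.1 * q.2 + s.1 * s.2 = 0 then (1:ℝ) else 0) =
      ∑ h1 ∈ HH N, ∑ h2 ∈ HH N, ∑ h3 ∈ HH N,
        (((I ×ˢ I ×ˢ I).filter (fun m => h1 * m.1 + h2 * m.2.1 + h3 * m.2.2 = 0)).card : ℝ) := by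
    simp_rw [hD, Finset.sum_product]
    refine Finset.sum_congr rfl fun h1 _ => ?_
    rw [Finset.sum_comm]
    refine Finset.sum_congr rfl fun h2 _ => ?_
    have : ∀ m1 ∈ I, (∑ m2 ∈ I, ∑ h3 ∈ HH N, ∑ m3 ∈ I,
        (if h1 * m1 + h2 * m2 + h3 * m3 = 0 then (1:ℝ) else 0)) =
        ∑ h3 ∈ HH N, ∑ m2 ∈ I, ∑ m3 ∈ I,
        (if h1 * m1 + h2 * m2 + h3 * m3 = 0 then (1:ℝ) else 0) := fun m1 _ => Finset.sum_comm
    rw [Finset.sum_congr rfl this, Finset.sum_comm]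
    refine Finset.sum_congr rfl fun h3 _ => ?_
    rw [Finset.card_filter, Finset.sum_product]
    simp_rw [Finset.sum_product]
    push_cast
    rfl
  rw [e5]
  have e6 : ∀ h1 ∈ HH N, ∀ h2 ∈ HH N, ∀ h3 ∈ HH N,
      (((I ×ˢ I ×ˢ I).filter (fun m => h1 * m.1 + h2 * m.2.1 + h3 * m.2.2 = 0)).card : ℝ) ≤
      9 * (Q:ℝ)^2 * ((Nat.gcd (Int.gcd h1 h2) h3.natAbs : ℝ) * (1 / √(h1.natAbs:ℝ)) * (1 / √(h2.natAbs:ℝ))) := by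
    intro h1 hh1 h2 hh2 h3 _
    simp only [HH, Finset.mem_erase, Finset.mem_Icc] at hh1 hh2
    have := three_card h1 h2 h3 Q hh1.1 hh2.1 (by rw [abs_le]; omega) (by rw [abs_le]; omega)
      ((I ×ˢ I ×ˢ I).filter (fun m => h1 * m.1 + h2 * m.2.1 + h3 * m.2.2 = 0)) (by
        intro p hp
        simp only [hI, Finset.mem_filter, Finset.mem_product, Finset.mem_Icc] at hp
        exact ⟨abs_le.2 hp.1.1, abs_le.2 hp.1.2.1, abs_le.2 hp.1.2.2, hp.2⟩)
    have p1 : 0 < √(h1.natAbs:ℝ) := Real.sqrt_pos.2 (by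
      have : 0 < h1.natAbs := by omega
      exact_mod_cast this)
    have p2 : 0 < √(h2.natAbs:ℝ) := Real.sqrt_pos.2 (by
      have : 0 < h2.natAbs := by omega
      exact_mod_cast this)
    rw [← le_div_iff₀ (by positivity)] at this
    refine this.trans (le_of_eq ?_)
    field_simp
  refine (Finset.sum_le_sum fun h1 hh1 => Finset.sum_le_sum fun h2 hh2 =>
      Finset.sum_le_sum fun h3 hh3 => e6 h1 hh1 h2 hh2 h3 hh3).trans ?_
  simp_rw [← Finset.mul_sum]
  have := gcd_sum N
  calc _ ≤ 9 * (Q:ℝ)^2 * (64 * (N:ℝ)^2) := mul_le_mul_of_nonneg_left this (by positivity)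
    _ = _ := by ring

lemma weyl (X : Finset ℤ) (f : ℤ → ℤ) (P : ℕ) (hX : ∀ x ∈ X, |x| ≤ P) (α : ℝ) :
    ‖TT X f α‖ ^ 2 ≤ ∑ h ∈ Finset.Icc (-((2 * P : ℕ):ℤ)) (2 * P : ℕ),
      ‖TT (X.filter (fun x => x + h ∈ X)) (fun x => f (x + h) - f x) α‖ := by
  classical
  have h1 : ((‖TT X f α‖ ^ 2 : ℝ) : ℂ) = ∑ h ∈ Finset.Icc (-((2 * P : ℕ):ℤ)) (2 * P : ℕ),
      TT (X.filter (fun x => x + h ∈ X)) (fun x => f (x + h) - f x) α := by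
    rw [TT_sq, ← Finset.sum_fiberwise_of_maps_to (t := Finset.Icc (-((2 * P : ℕ):ℤ)) (2 * P : ℕ))
      (g := fun p : ℤ × ℤ => p.1 - p.2)]
    · refine Finset.sum_congr rfl fun h _ => ?_
      unfold TT
      refine Finset.sum_nbij' (fun p => p.2) (fun x => (x + h, x)) ?_ ?_ ?_ ?_ ?_
      · rintro ⟨a, b⟩ hp
        simp only [Finset.mem_filter, Finset.mem_product] at hp ⊢
        refine ⟨hp.1.2, ?_⟩
        have : b + h = a := by omega
        rw [this]; exact hp.1.1
      · intro x hx
        simp only [Finset.mem_filter, Finset.mem_product] at hx ⊢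
        exact ⟨⟨hx.2, hx.1⟩, by ring⟩
      · rintro ⟨a, b⟩ hp
        simp only [Finset.mem_filter, Finset.mem_product] at hp ⊢
        ext <;> simp <;> omega
      · intro x _; rfl
      · rintro ⟨a, b⟩ hp
        simp only [Finset.mem_filter, Finset.mem_product] at hp ⊢
        have : b + h = a := by omega
        rw [this]
    · rintro ⟨a, b⟩ hp
      have := Finset.mem_product.1 hp
      have ha := abs_le.1 (hX _ this.1)
      have hb := abs_le.1 (hX _ this.2)
      simp only [Finset.mem_Icc] at *
      omega
  have h2 : ‖TT X f α‖ ^ 2 = ‖((‖TT X f α‖ ^ 2 : ℝ) : ℂ)‖ := by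
    rw [Complex.norm_real, Real.norm_of_nonneg (by positivity)]
  rw [h2, h1]
  exact norm_sum_le _ _

def Claim (k : ℕ) : Prop := ∃ t : ℕ, 1 ≤ t ∧ ∀ c : ℕ, ∃ C : ℝ, 0 ≤ C ∧ ∀ P : ℕ, 1 ≤ P →
  ∀ a : ℕ → ℤ, a k ≠ 0 → (∀ i ≤ k, |a i| ≤ c * (P:ℤ) ^ (k - i)) →
  ∀ X : Finset ℤ, (∀ x ∈ X, |x| ≤ P) →
    (∫ α in (0:ℝ)..1, ‖TT X (pol k a) α‖ ^ (2 * t)) * (P:ℝ) ^ k ≤ C * (P:ℝ) ^ (2 * t)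

lemma card_X (X : Finset ℤ) (P : ℕ) (hP : 1 ≤ P) (hX : ∀ x ∈ X, |x| ≤ P) : (X.card : ℝ) ≤ 3 * P := by
  have : X.card ≤ (Finset.Icc (-(P:ℤ)) P).card :=
    Finset.card_le_card fun x hx => Finset.mem_Icc.2 (abs_le.1 (hX x hx))
  rw [Int.card_Icc] at this
  have : X.card ≤ 3 * P := by omega
  exact_mod_cast this

lemma claim_one : Claim 1 := by
  classical
  refine ⟨1, le_rfl, fun c => ⟨3, by norm_num, fun P hP a ha _ X hX => ?_⟩⟩
  have h1 : (∫ α in (0:ℝ)..1, ‖TT X (pol 1 a) α‖ ^ 2) = X.card := by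
    apply Complex.ofReal_injective
    rw [← intervalIntegral.integral_ofReal]
    simp_rw [TT_sq]
    rw [intervalIntegral.integral_finsetSum
      (fun p _ => (ee_cont _).intervalIntegrable _ _)]
    simp_rw [ee_int]
    rw [Finset.sum_product]
    have : ∀ x y : ℤ, pol 1 a x - pol 1 a y = 0 ↔ x = y := by
      intro x y
      simp only [pol, Finset.sum_range_succ, Finset.sum_range_zero]
      constructor
      · intro h
        have : a 1 * (x - y) = 0 := by linarith
        rcases mul_eq_zero.1 this with h | h
        · exact absurd h ha
        · omega
      · rintro rfl; ring
    simp_rw [this]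
    simp
  rw [mul_one, h1]
  have := card_X X P hP hX
  have hp : (1:ℝ) ≤ P := by exact_mod_cast hP
  nlinarith

lemma int_mono {F G : ℝ → ℝ} (hF : Continuous F) (hG : Continuous G) (h : ∀ x, F x ≤ G x) :
    (∫ α in (0:ℝ)..1, F α) ≤ ∫ α in (0:ℝ)..1, G α :=
  intervalIntegral.integral_mono_on zero_le_one (hF.intervalIntegrable _ _)
    (hG.intervalIntegrable _ _) (fun x _ => h x)

lemma claim_step (k : ℕ) (hk : 1 ≤ k) (ih : Claim k) : Claim (k + 1) := by
  classical
  obtain ⟨t, ht, IH⟩ := ih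
  obtain ⟨τ, hτ⟩ : ∃ τ, 2 * t = τ + 1 := ⟨2 * t - 1, by omega⟩
  refine ⟨2 * t * (k + 3), Nat.mul_pos (by omega) (by omega), fun c => ?_⟩
  set c' : ℕ := (k + 2) * (c * 4 ^ (k + 1)) + 1 with hc'
  obtain ⟨C', hC'0, hC'⟩ := IH c'
  set E : ℕ := 2 * t * ((k + 1) * c') with hE
  set K1 : ℝ := (5 ^ τ) ^ (k + 3) * 2 ^ (k + 3) with hK1
  set K2 : ℝ := (3 ^ (2 * t)) ^ (k + 3) with hK2
  set K3 : ℝ := (4 * 3 ^ (2 * t)) ^ k * (C' ^ 3 * (576 * (E:ℝ) ^ 2 * 4)) with hK3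
  refine ⟨K1 * (K2 + K3), by positivity, fun P hP a ha hab X hX => ?_⟩
  set p : ℝ := (P:ℝ) with hp
  have hp1 : 1 ≤ p := by rw [hp]; exact_mod_cast hP
  have hp0 : 0 < p := by linarith
  set f := pol (k + 1) a with hf
  set Xh : ℤ → Finset ℤ := fun h => X.filter (fun x => x + h ∈ X) with hXh
  have hXhb : ∀ h, ∀ x ∈ Xh h, |x| ≤ P := fun h x hx => hX x (Finset.mem_filter.1 hx).1
  set F : ℤ → ℝ → ℝ := fun h β => ‖TT (Xh h) (pol k (dif k a h)) β‖ ^ (2 * t) with hF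
  have hFc : ∀ h, Continuous (F h) := fun h => (TT_cont _ _).norm.pow _
  set U : ℝ → ℝ := fun α => ∑ h ∈ HH (2 * P), F h (h * α) with hU
  have hUc : Continuous U := continuous_finsetSum _ fun h _ =>
    (hFc h).comp (continuous_const.mul continuous_id)
  have hU0 : ∀ α, 0 ≤ U α := fun α => Finset.sum_nonneg fun h _ => by positivity
  have hFle : ∀ h β, F h β ≤ (3 * p) ^ (2 * t) := by
    intro h β
    refine pow_le_pow_left₀ (norm_nonneg _) ?_ _
    exact (TT_norm_le _ _ _).trans (card_X _ P hP (hXhb h))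
  have hcard : ((HH (2 * P)).card : ℝ) = 4 * p := by
    have := sum_HH (2 * P) (fun _ => (1:ℝ))
    simp at this
    rw [this]; ring
  have hUle : ∀ α, U α ≤ 4 * p * (3 * p) ^ (2 * t) := by
    intro α
    calc U α ≤ ∑ h ∈ HH (2 * P), (3 * p) ^ (2 * t) := Finset.sum_le_sum fun h _ => hFle _ _
      _ = _ := by rw [Finset.sum_const, nsmul_eq_mul, hcard]
  -- coefficients
  have hbd : ∀ h ∈ HH (2 * P), ∀ i ≤ k, |dif k a h i| ≤ (c' : ℤ) * (P:ℤ) ^ (k - i) := by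
    intro h hh i hi
    simp only [HH, Finset.mem_erase, Finset.mem_Icc] at hh
    refine (dif_bound k c P a h (by rw [abs_le]; push_cast at hh; omega) hab i hi).trans ?_
    gcongr
    omega
  set B : ℝ := C' * p ^ (2 * t) / p ^ k with hB
  have hint : ∀ h ∈ HH (2 * P), (∫ α in (0:ℝ)..1, F h α) ≤ B := by
    intro h hh
    rw [hB, le_div_iff₀ (by positivity)]
    refine hC' P hP (dif k a h) ?_ (hbd h hh) (Xh h) (hXhb h)
    rw [dif_top]
    exact mul_ne_zero ha (by positivity)
  set Q : ℕ := 2 * t * ((k + 1) * c' * P ^ k) with hQ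
  have hQE : (Q:ℝ) = E * p ^ k := by rw [hQ, hE, hp]; push_cast; ring
  have hNQ : 2 * P ≤ Q := by
    have h1 : 1 ≤ (k + 1) * c' := Nat.mul_pos (by omega) (by omega)
    have h2 : P ≤ P ^ k := Nat.le_self_pow (by omega) _
    calc 2 * P ≤ (2 * t) * (1 * P ^ k) := Nat.mul_le_mul (by omega) (by omega)
      _ ≤ _ := by rw [hQ]; gcongr
  have hexp : ∀ h : ℤ, ∃ r : ℤ → ℝ, (∀ m, 0 ≤ r m) ∧ (h ∈ HH (2 * P) → ∀ β : ℝ,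
      ((F h β : ℝ) : ℂ) = ∑ m ∈ Finset.Icc (-(Q:ℤ)) Q, (r m : ℂ) * ee m β) := by
    intro h
    by_cases hh : h ∈ HH (2 * P)
    · obtain ⟨r, h1, h2⟩ := TT_expand (Xh h) (pol k (dif k a h)) t ((k + 1) * c' * P ^ k)
        (fun x hx => pol_bound k c' P _ (hbd h hh) x (hXhb h x hx))
      exact ⟨r, h1, fun _ => h2⟩
    · exact ⟨0, fun m => le_rfl, fun h' => absurd h' hh⟩
  choose r hr0 hrF using hexp
  have hU3 : (∫ α in (0:ℝ)..1, U α ^ 3) ≤ B ^ 3 * (576 * (Q:ℝ) ^ 2 * ((2 * P : ℕ):ℝ) ^ 2) :=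
    U_cube (2 * P) Q hNQ B (by positivity) F r hrF hr0 (fun h hh m hm =>
      (coef_le (F h) (fun α => by positivity) _ (r h) (hrF h hh) m hm).trans (hint h hh))
  -- pointwise bound
  have hpt1 : ∀ α, ‖TT X f α‖ ^ (2 * (2 * t)) ≤ (5 * p) ^ τ * ((3 * p) ^ (2 * t) + U α) := by
    intro α
    have w := weyl X f P hX α
    set A := Finset.Icc (-((2 * P : ℕ):ℤ)) (2 * P : ℕ) with hA
    set u : ℤ → ℝ := fun h => ‖TT (X.filter (fun x => x + h ∈ X)) (fun x => f (x + h) - f x) α‖ with hu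
    have hAc : (A.card : ℝ) ≤ 5 * p := by
      rw [hA, Int.card_Icc]
      have : ((2 * P : ℕ) + 1 - -((2 * P : ℕ):ℤ)).toNat ≤ 5 * P := by omega
      rw [hp]; exact_mod_cast this
    have hAc0 : (0:ℝ) < A.card := by
      have : (0:ℤ) ∈ A := by simp [hA]
      exact_mod_cast Finset.card_pos.2 ⟨0, this⟩
    have pw := pow_sum_le_card_mul_sum_pow (s := A) (f := u) (fun h _ => norm_nonneg _) τ
    have hsum : ∑ h ∈ A, u h ^ (τ + 1) ≤ (3 * p) ^ (2 * t) + U α := by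
      have h0A : (0:ℤ) ∈ A := by simp [hA]
      rw [← Finset.add_sum_erase A _ h0A, ← hτ]
      refine add_le_add ?_ (le_of_eq ?_)
      · refine pow_le_pow_left₀ (norm_nonneg _) ?_ _
        exact (TT_norm_le _ _ _).trans (card_X _ P hP (hXhb 0))
      · rw [hU]
        refine Finset.sum_congr rfl fun h hh => ?_
        simp only [hu, hF, hXh]
        congr 2
        unfold TT
        refine Finset.sum_congr rfl fun x _ => ?_
        simp only [hf]
        rw [← dif_eval, ee_mul]
    calc ‖TT X f α‖ ^ (2 * (2 * t)) = (‖TT X f α‖ ^ 2) ^ (τ + 1) := by rw [← hτ, ← pow_mul]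
      _ ≤ (∑ h ∈ A, u h) ^ (τ + 1) := pow_le_pow_left₀ (by positivity) w _
      _ ≤ (A.card : ℝ) ^ τ * ∑ h ∈ A, u h ^ (τ + 1) := pw
      _ ≤ (5 * p) ^ τ * ((3 * p) ^ (2 * t) + U α) := by
          have : 0 ≤ ∑ h ∈ A, u h ^ (τ + 1) := Finset.sum_nonneg fun h _ => by positivity
          gcongr
  have hpt2 : ∀ α, ‖TT X f α‖ ^ (2 * (2 * t * (k + 3))) ≤
      ((5 * p) ^ τ) ^ (k + 3) * 2 ^ (k + 3) *
        (((3 * p) ^ (2 * t)) ^ (k + 3) + (4 * p * (3 * p) ^ (2 * t)) ^ k * U α ^ 3) := by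
    intro α
    have hu := hU0 α
    have hb := hUle α
    calc ‖TT X f α‖ ^ (2 * (2 * t * (k + 3))) = (‖TT X f α‖ ^ (2 * (2 * t))) ^ (k + 3) := by
          rw [← pow_mul]; congr 1; ring
      _ ≤ ((5 * p) ^ τ * ((3 * p) ^ (2 * t) + U α)) ^ (k + 3) :=
          pow_le_pow_left₀ (by positivity) (hpt1 α) _
      _ = ((5 * p) ^ τ) ^ (k + 3) * ((3 * p) ^ (2 * t) + U α) ^ (k + 3) := by rw [mul_pow]
      _ ≤ ((5 * p) ^ τ) ^ (k + 3) * (2 ^ (k + 3) * (((3 * p) ^ (2 * t)) ^ (k + 3) + U α ^ (k + 3))) := by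
          gcongr
          refine (add_pow_le (by positivity) hu _).trans ?_
          gcongr
          · norm_num
          · omega
      _ ≤ ((5 * p) ^ τ) ^ (k + 3) * (2 ^ (k + 3) * (((3 * p) ^ (2 * t)) ^ (k + 3) +
            (4 * p * (3 * p) ^ (2 * t)) ^ k * U α ^ 3)) := by
          rw [pow_add (U α)]
          gcongr
      _ = _ := by ring
  have hI := int_mono ((TT_cont X f).norm.pow (2 * (2 * t * (k + 3))))
    (continuous_const.mul (continuous_const.add (continuous_const.mul (hUc.pow 3)))) hpt2
  have hI2 : (∫ α in (0:ℝ)..1, ((5 * p) ^ τ) ^ (k + 3) * 2 ^ (k + 3) *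
        (((3 * p) ^ (2 * t)) ^ (k + 3) + (4 * p * (3 * p) ^ (2 * t)) ^ k * U α ^ 3)) =
      ((5 * p) ^ τ) ^ (k + 3) * 2 ^ (k + 3) *
        (((3 * p) ^ (2 * t)) ^ (k + 3) + (4 * p * (3 * p) ^ (2 * t)) ^ k * ∫ α in (0:ℝ)..1, U α ^ 3) := by
    have hc3 : Continuous (fun α => (4 * p * (3 * p) ^ (2 * t)) ^ k * U α ^ 3) := by fun_prop
    rw [intervalIntegral.integral_const_mul, intervalIntegral.integral_add
      (continuous_const.intervalIntegrable _ _)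
      (hc3.intervalIntegrable _ _),
      intervalIntegral.integral_const_mul]
    simp
  have hU3' : (∫ α in (0:ℝ)..1, U α ^ 3) * p ^ k ≤ C' ^ 3 * (576 * (E:ℝ) ^ 2 * 4) * p ^ (6 * t + 2) := by
    refine (mul_le_mul_of_nonneg_right hU3 (by positivity)).trans (le_of_eq ?_)
    rw [hB, hQE]
    push_cast
    rw [← hp]
    field_simp
    ring
  calc (∫ α in (0:ℝ)..1, ‖TT X f α‖ ^ (2 * (2 * t * (k + 3)))) * p ^ (k + 1)
      ≤ (((5 * p) ^ τ) ^ (k + 3) * 2 ^ (k + 3) *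
        (((3 * p) ^ (2 * t)) ^ (k + 3) + (4 * p * (3 * p) ^ (2 * t)) ^ k * ∫ α in (0:ℝ)..1, U α ^ 3)) * p ^ (k + 1) := by
        rw [← hI2]
        exact mul_le_mul_of_nonneg_right hI (by positivity)
    _ = K1 * (K2 * (p ^ (τ * (k + 3) + 2 * t * (k + 3) + (k + 1))) +
          (4 * 3 ^ (2 * t)) ^ k * (p ^ (τ * (k + 3) + (2 * t + 1) * k + 1)) *
            ((∫ α in (0:ℝ)..1, U α ^ 3) * p ^ k)) := by
        rw [hK1, hK2]
        simp only [mul_pow, pow_add, pow_mul, pow_one]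
        ring
    _ ≤ K1 * (K2 * (p ^ (2 * (2 * t * (k + 3)))) +
          (4 * 3 ^ (2 * t)) ^ k * (p ^ (τ * (k + 3) + (2 * t + 1) * k + 1)) *
            (C' ^ 3 * (576 * (E:ℝ) ^ 2 * 4) * p ^ (6 * t + 2))) := by
        gcongr
        have : τ * (k + 3) + (k + 3) = 2 * t * (k + 3) := by rw [hτ]; ring
        linarith
    _ = K1 * (K2 * (p ^ (2 * (2 * t * (k + 3)))) +
          K3 * p ^ (τ * (k + 3) + (2 * t + 1) * k + 1 + (6 * t + 2))) := by
        rw [hK3, pow_add p _ (6 * t + 2)]; ring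
    _ = K1 * (K2 + K3) * p ^ (2 * (2 * t * (k + 3))) := by
        have : τ * (k + 3) + (2 * t + 1) * k + 1 + (6 * t + 2) = 2 * (2 * t * (k + 3)) := by
          have : τ * (k + 3) + (k + 3) = 2 * t * (k + 3) := by rw [hτ]; ring
          linarith
        rw [this]; ring

lemma claim_all (k : ℕ) (hk : 1 ≤ k) : Claim k := by
  induction k, hk using Nat.le_induction with
  | base => exact claim_one
  | succ k hk ih => exact claim_step k hk ih

theorem stmt5 (k : ℕ) (hk : 1 ≤ k) :
    ∃ s₀ : ℕ, ∀ f : Polynomial ℤ, f.natDegree = k → 0 < f.leadingCoeff →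
      ∀ s : ℕ, s₀ ≤ s → ∃ C : ℝ, ∀ M : ℕ, 1 ≤ M →
        (∫ α in (0:ℝ)..1, ‖SM f M α‖ ^ s) ≤ C * (M : ℝ) ^ ((s : ℝ) - k) := by
  obtain ⟨t, ht, H⟩ := claim_all k hk
  refine ⟨2 * t, fun f hf hlead s hs => ?_⟩
  set c : ℕ := ∑ i ∈ Finset.range (k + 1), (f.coeff i).natAbs with hc
  obtain ⟨C, hC0, hC⟩ := H c
  refine ⟨C, fun M hM => ?_⟩
  have hM0 : (0:ℝ) < M := by exact_mod_cast hM
  set X : Finset ℤ := (Finset.Icc 1 M).map ⟨fun n : ℕ => (n:ℤ), Nat.cast_injective⟩ with hX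
  have hXc : X.card = M := by rw [hX, Finset.card_map]; simp
  have hS : ∀ α, SM f M α = TT X (pol k (fun i => f.coeff i)) α := by
    intro α
    unfold SM TT
    rw [hX, Finset.sum_map]
    refine Finset.sum_congr rfl fun d _ => ?_
    unfold ee pol
    rw [Polynomial.eval_eq_sum_range, hf]
    rfl
  have h1 := hC M hM (fun i => f.coeff i) (by
      rw [← hf]; exact hlead.ne') (by
      intro i hi
      have h2 : (f.coeff i).natAbs ≤ c := Finset.single_le_sum (f := fun i => (f.coeff i).natAbs)
        (fun _ _ => Nat.zero_le _) (Finset.mem_range.2 (by omega))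
      have h3 : (1:ℤ) ≤ (M:ℤ) ^ (k - i) := one_le_pow₀ (by exact_mod_cast hM)
      have h4 : |f.coeff i| ≤ (c:ℤ) := by rw [Int.abs_eq_natAbs]; exact_mod_cast h2
      calc |f.coeff i| ≤ (c:ℤ) * 1 := by linarith
        _ ≤ _ := by gcongr) X (by
      intro x hx
      simp only [hX, Finset.mem_map, Finset.mem_Icc, Function.Embedding.coeFn_mk] at hx
      obtain ⟨n, hn, rfl⟩ := hx
      change |(n:ℤ)| ≤ M
      rw [abs_le]; omega)
  have h2 : (∫ α in (0:ℝ)..1, ‖SM f M α‖ ^ s) ≤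
      ∫ α in (0:ℝ)..1, (M:ℝ) ^ (s - 2 * t) * ‖TT X (pol k (fun i => f.coeff i)) α‖ ^ (2 * t) := by
    simp_rw [hS]
    refine int_mono ((TT_cont _ _).norm.pow _) (continuous_const.mul ((TT_cont _ _).norm.pow _)) ?_
    intro α
    have h3 := TT_norm_le X (pol k (fun i => f.coeff i)) α
    rw [hXc] at h3
    calc ‖TT X (pol k (fun i => f.coeff i)) α‖ ^ s
        = ‖TT X (pol k (fun i => f.coeff i)) α‖ ^ (s - 2 * t) *
          ‖TT X (pol k (fun i => f.coeff i)) α‖ ^ (2 * t) := by rw [← pow_add]; congr 1; omega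
      _ ≤ _ := by gcongr
  rw [intervalIntegral.integral_const_mul] at h2
  refine h2.trans ?_
  rw [Real.rpow_sub hM0, Real.rpow_natCast, Real.rpow_natCast, mul_div_assoc', le_div_iff₀ (by positivity)]
  calc _ = (M:ℝ) ^ (s - 2 * t) * ((∫ α in (0:ℝ)..1, ‖TT X (pol k (fun i => f.coeff i)) α‖ ^ (2 * t)) * (M:ℝ) ^ k) := by ring
    _ ≤ (M:ℝ) ^ (s - 2 * t) * (C * (M:ℝ) ^ (2 * t)) := by gcongr
    _ = C * ((M:ℝ) ^ (s - 2 * t) * (M:ℝ) ^ (2 * t)) := by ring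
    _ = C * (M:ℝ) ^ s := by rw [← pow_add]; congr 2; omega
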